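/- arXiv:0912.1635 — 2 statements merged into one kernel-verified Lean document; each statement's English description precedes it below -/
import Mathlib

section
/- Let f(t₁,…,t_d) be an ℝ-valued infinitely differentiable function on an open subset of ℝᵈ on which t_j ≠ 0. Then for every n ∈ ℕ, ∂_{t_j}² D_{t_j}(n){f} = D_{t_j}(n){∂_{t_j}² f} − 2n D_{t_j}(n+1){f}. -/
noncomputable section

/-- The partial derivative `∂_{t_j}` of `f : ℝᵈ → ℝ`. -/
def pdj (d : ℕ) (j : Fin d) (f : (Fin d → ℝ) → ℝ) : (Fin d → ℝ) → ℝ :=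
  fun t => fderiv ℝ f t (Pi.single j 1)

/-- The operator `D_{t_j}(n)`: `D_{t_j}(0){f} = f`,
`D_{t_j}(n+1){f} = (1/t_j) ∂_{t_j}(D_{t_j}(n){f})`. -/
def DlowJ (d : ℕ) (j : Fin d) : ℕ → ((Fin d → ℝ) → ℝ) → ((Fin d → ℝ) → ℝ)
  | 0, f => f
  | n + 1, f => fun t => (t j)⁻¹ * pdj d j (DlowJ d j n f) t

/-- The operator `D^{t_j}(n)`: `D^{t_j}(0){f} = f`,
`D^{t_j}(n){f} = ∂_{t_j}(D^{t_j}(n-1){f} / t_j)`. -/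
def DupJ (d : ℕ) (j : Fin d) : ℕ → ((Fin d → ℝ) → ℝ) → ((Fin d → ℝ) → ℝ)
  | 0, f => f
  | n + 1, f => pdj d j (fun t => DupJ d j n f t / t j)

section

variable {d : ℕ} {j : Fin d} {U : Set (Fin d → ℝ)} {f g : (Fin d → ℝ) → ℝ} {t : Fin d → ℝ}

lemma Set.EqOn.pdj (h : Set.EqOn f g U) (hU : IsOpen U) : Set.EqOn (pdj d j f) (pdj d j g) U := by
  intro t ht
  have hfg : f =ᶠ[nhds t] g := h.eventuallyEq_of_mem (hU.mem_nhds ht)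
  simp only [_root_.pdj, hfg.fderiv_eq]

lemma ContDiffOn.pdj (hf : ContDiffOn ℝ (⊤ : ℕ∞) f U) (hU : IsOpen U) :
    ContDiffOn ℝ (⊤ : ℕ∞) (pdj d j f) U :=
  (hf.fderiv_of_isOpen hU (by simp)).clm_apply contDiffOn_const

lemma ContDiffOn.inv_coord_mul (hf : ContDiffOn ℝ (⊤ : ℕ∞) f U) (hUj : ∀ t ∈ U, t j ≠ 0) :
    ContDiffOn ℝ (⊤ : ℕ∞) (fun t => (t j)⁻¹ * f t) U :=
  ((contDiff_apply ℝ ℝ j).contDiffOn.inv hUj).mul hf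

lemma ContDiffOn.DlowJ (hf : ContDiffOn ℝ (⊤ : ℕ∞) f U) (hU : IsOpen U)
    (hUj : ∀ t ∈ U, t j ≠ 0) (n : ℕ) : ContDiffOn ℝ (⊤ : ℕ∞) (DlowJ d j n f) U := by
  induction n with
  | zero => exact hf
  | succ n ih => exact (ih.pdj hU).inv_coord_mul hUj

lemma ContDiffOn.differentiableAt_of_isOpen (hf : ContDiffOn ℝ (⊤ : ℕ∞) f U) (hU : IsOpen U)
    (ht : t ∈ U) : DifferentiableAt ℝ f t :=
  (hf.contDiffAt (hU.mem_nhds ht)).differentiableAt (by simp)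

lemma pdj_sub (hf : DifferentiableAt ℝ f t) (hg : DifferentiableAt ℝ g t) :
    pdj d j (fun t => f t - g t) t = pdj d j f t - pdj d j g t := by
  simp [pdj, fderiv_fun_sub hf hg]

lemma pdj_const_mul (c : ℝ) (hf : DifferentiableAt ℝ f t) :
    pdj d j (fun t => c * f t) t = c * pdj d j f t := by
  simp [pdj, fderiv_const_mul hf]

lemma pdj_inv_coord_mul (hf : DifferentiableAt ℝ f t) (ht : t j ≠ 0) :
    pdj d j (fun t => (t j)⁻¹ * f t) t = (t j)⁻¹ * (pdj d j f t - (t j)⁻¹ * f t) := by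
  have hinv := (hasDerivAt_inv ht).comp_hasFDerivAt t (hasFDerivAt_apply (𝕜 := ℝ) j t)
  have h := (hinv.mul hf.hasFDerivAt).fderiv
  change fderiv ℝ (fun t : Fin d → ℝ => (t j)⁻¹ * f t) t = _ at h
  simp only [pdj, h]
  simp
  field_simp
  ring

/-- The commutation relation `∂² D = D ∂² - 2 D²`, where `D = t_j⁻¹ ∂`. -/
lemma pdj_pdj_DlowJ_one (hU : IsOpen U) (hUj : ∀ t ∈ U, t j ≠ 0)
    (hg : ContDiffOn ℝ (⊤ : ℕ∞) g U) (ht : t ∈ U) :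
    pdj d j (pdj d j (DlowJ d j 1 g)) t
      = DlowJ d j 1 (pdj d j (pdj d j g)) t - 2 * DlowJ d j 2 g t := by
  have h1 := hg.pdj (j := j) hU
  have h2 := h1.pdj (j := j) hU
  have h3 := h1.inv_coord_mul hUj
  have hfirst : Set.EqOn (pdj d j (DlowJ d j 1 g))
      (fun t => (t j)⁻¹ * (pdj d j (pdj d j g) t - (t j)⁻¹ * pdj d j g t)) U := fun s hs =>
    pdj_inv_coord_mul (h1.differentiableAt_of_isOpen hU hs) (hUj s hs)
  rw [hfirst.pdj hU ht,
    pdj_inv_coord_mul ((h2.sub h3).differentiableAt_of_isOpen hU ht) (hUj t ht),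
    pdj_sub (h2.differentiableAt_of_isOpen hU ht) (h3.differentiableAt_of_isOpen hU ht),
    pdj_inv_coord_mul (h1.differentiableAt_of_isOpen hU ht) (hUj t ht)]
  simp only [DlowJ]
  rw [pdj_inv_coord_mul (h1.differentiableAt_of_isOpen hU ht) (hUj t ht)]
  ring

end

/-- **Lemma 1 (i):** `∂_{t_j}² D_{t_j}(n){f} = D_{t_j}(n){∂_{t_j}² f} − 2n D_{t_j}(n+1){f}`
for a smooth function `f` on an open set where `t_j ≠ 0`. -/
theorem lemma1_i (d : ℕ) (j : Fin d) (U : Set (Fin d → ℝ)) (hU : IsOpen U)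
    (hUj : ∀ t ∈ U, t j ≠ 0) (f : (Fin d → ℝ) → ℝ) (hf : ContDiffOn ℝ (⊤ : ℕ∞) f U) (n : ℕ) :
    ∀ t ∈ U, pdj d j (pdj d j (DlowJ d j n f)) t
      = DlowJ d j n (pdj d j (pdj d j f)) t - (2 * n : ℝ) * DlowJ d j (n + 1) f t := by
  induction n with
  | zero => simp [DlowJ]
  | succ n ih =>
    intro t ht
    have hD := hf.DlowJ hU hUj n
    have hD' := (hf.DlowJ hU hUj (n + 1)).differentiableAt_of_isOpen hU ht
    have hDf := (((hf.pdj (j := j) hU).pdj (j := j) hU).DlowJ hU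
      hUj n).differentiableAt_of_isOpen hU ht
    have hstep := (Set.EqOn.pdj (j := j) ih hU) ht
    rw [pdj_sub hDf (hD'.const_mul _), pdj_const_mul _ hD'] at hstep
    have hcomm := pdj_pdj_DlowJ_one hU hUj hD ht
    simp only [DlowJ] at hcomm hstep ⊢
    rw [hcomm, hstep]
    push_cast
    ring
end
end

section
/- Let n ∈ ℕ and let U, V be ℝ-valued infinitely differentiable functions on an open set Ξ ⊂ ℝ²₊ = {(t₁,t₂) : t₂ > 0} satisfying ∂_{t₁}U − ∂_{t₂}V = 0 and ∂_{t₁}V + ∂_{t₂}U = 0 on Ξ. Define A = D_{t₂}(n){U} and B = D^{t₂}(n){V}. Then A and B satisfy the Vekua-type system ∂_{t₁}A − ∂_{t₂}B = (2n/t₂) B and ∂_{t₁}B + ∂_{t₂}A = 0 on Ξ. -/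
noncomputable section

/-- Partial derivative in the first variable for functions on `ℝ²`. -/
def pd1 (g : ℝ × ℝ → ℝ) : ℝ × ℝ → ℝ := fun p => fderiv ℝ g p (1, 0)

/-- Partial derivative in the second variable for functions on `ℝ²`. -/
def pd2 (g : ℝ × ℝ → ℝ) : ℝ × ℝ → ℝ := fun p => fderiv ℝ g p (0, 1)

/-- The operator `D_{t₂}(n)`: `D_{t₂}(0){h} = h`, `D_{t₂}(n+1){h} = (1/t₂) ∂_{t₂}(D_{t₂}(n){h})`. -/
def Dlow : ℕ → (ℝ × ℝ → ℝ) → (ℝ × ℝ → ℝ)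
  | 0, g => g
  | n + 1, g => fun p => (p.2)⁻¹ * pd2 (Dlow n g) p

/-- The operator `D^{t₂}(n)`: `D^{t₂}(0){h} = h`, `D^{t₂}(n){h} = ∂_{t₂}(D^{t₂}(n-1){h}/t₂)`. -/
def Dup : ℕ → (ℝ × ℝ → ℝ) → (ℝ × ℝ → ℝ)
  | 0, g => g
  | n + 1, g => pd2 (fun p => Dup n g p / p.2)

section

open Set

variable {Ξ : Set (ℝ × ℝ)} {f g : ℝ × ℝ → ℝ} {p : ℝ × ℝ}

theorem pd1_congr_of_eqOn (hΞ : IsOpen Ξ) (h : EqOn f g Ξ) (hp : p ∈ Ξ) :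
    pd1 f p = pd1 g p := by
  simp only [pd1, (h.eventuallyEq_of_mem (hΞ.mem_nhds hp)).fderiv_eq]

theorem pd2_congr_of_eqOn (hΞ : IsOpen Ξ) (h : EqOn f g Ξ) (hp : p ∈ Ξ) :
    pd2 f p = pd2 g p := by
  simp only [pd2, (h.eventuallyEq_of_mem (hΞ.mem_nhds hp)).fderiv_eq]

theorem contDiffOn_pd1 (hΞ : IsOpen Ξ) (hf : ContDiffOn ℝ (⊤ : ℕ∞) f Ξ) :
    ContDiffOn ℝ (⊤ : ℕ∞) (pd1 f) Ξ :=
  (hf.fderiv_of_isOpen hΞ (m := (⊤ : ℕ∞)) le_rfl).clm_apply contDiffOn_const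

theorem contDiffOn_pd2 (hΞ : IsOpen Ξ) (hf : ContDiffOn ℝ (⊤ : ℕ∞) f Ξ) :
    ContDiffOn ℝ (⊤ : ℕ∞) (pd2 f) Ξ :=
  (hf.fderiv_of_isOpen hΞ (m := (⊤ : ℕ∞)) le_rfl).clm_apply contDiffOn_const

theorem differentiableAt_of_contDiffOn_top (hΞ : IsOpen Ξ)
    (hf : ContDiffOn ℝ (⊤ : ℕ∞) f Ξ) (hp : p ∈ Ξ) : DifferentiableAt ℝ f p :=
  (hf.contDiffAt (hΞ.mem_nhds hp)).differentiableAt (by simp)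

theorem pd1_pd2_comm (hΞ : IsOpen Ξ) (hf : ContDiffOn ℝ (⊤ : ℕ∞) f Ξ) (hp : p ∈ Ξ) :
    pd1 (pd2 f) p = pd2 (pd1 f) p := by
  have hd : DifferentiableAt ℝ (fderiv ℝ f) p :=
    ((hf.fderiv_of_isOpen hΞ (m := (⊤ : ℕ∞)) le_rfl).contDiffAt
      (hΞ.mem_nhds hp)).differentiableAt (by simp)
  have key (v w : ℝ × ℝ) :
      fderiv ℝ (fun q => fderiv ℝ f q v) p w = fderiv ℝ (fderiv ℝ f) p w v := by
    rw [fderiv_clm_apply hd (differentiableAt_const v)]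
    simp
  have hsymm : IsSymmSndFDerivAt ℝ f p :=
    (hf.contDiffAt (hΞ.mem_nhds hp)).isSymmSndFDerivAt (by
      rw [minSmoothness_of_isRCLikeNormedField]
      exact WithTop.coe_le_coe.2 le_top)
  exact (key _ _).trans ((hsymm _ _).trans (key _ _).symm)

theorem pd1_snd_mul (hf : DifferentiableAt ℝ f p) :
    pd1 (fun q => q.2 * f q) p = p.2 * pd1 f p := by
  simp [pd1, fderiv_fun_mul differentiableAt_snd hf, fderiv_snd]

theorem pd2_snd_mul (hf : DifferentiableAt ℝ f p) :
    pd2 (fun q => q.2 * f q) p = f p + p.2 * pd2 f p := by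
  simp [pd2, fderiv_fun_mul differentiableAt_snd hf, fderiv_snd, add_comm]

theorem contDiffOn_Dlow (hΞ : IsOpen Ξ) (hsnd : ∀ q ∈ Ξ, q.2 ≠ 0)
    (hf : ContDiffOn ℝ (⊤ : ℕ∞) f Ξ) (n : ℕ) : ContDiffOn ℝ (⊤ : ℕ∞) (Dlow n f) Ξ := by
  induction n with
  | zero => exact hf
  | succ n ih => exact (contDiffOn_snd.inv hsnd).mul (contDiffOn_pd2 hΞ ih)

theorem contDiffOn_Dup (hΞ : IsOpen Ξ) (hsnd : ∀ q ∈ Ξ, q.2 ≠ 0)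
    (hf : ContDiffOn ℝ (⊤ : ℕ∞) f Ξ) (n : ℕ) : ContDiffOn ℝ (⊤ : ℕ∞) (Dup n f) Ξ := by
  induction n with
  | zero => exact hf
  | succ n ih => exact contDiffOn_pd2 hΞ (ih.div contDiffOn_snd hsnd)

/-- The Vekua system with coefficient `c / t₂` is carried to the one with coefficient
`(c + 2) / t₂` by `A ↦ (∂_{t₂} A) / t₂`, `B ↦ ∂_{t₂} (B / t₂)`. -/
theorem vekua_step (hΞ : IsOpen Ξ) (hsnd : ∀ q ∈ Ξ, q.2 ≠ 0) {A B : ℝ × ℝ → ℝ} {c : ℝ}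
    (hA : ContDiffOn ℝ (⊤ : ℕ∞) A Ξ) (hB : ContDiffOn ℝ (⊤ : ℕ∞) B Ξ)
    (h1 : ∀ q ∈ Ξ, pd1 A q - pd2 B q = c / q.2 * B q)
    (h2 : ∀ q ∈ Ξ, pd1 B q + pd2 A q = 0) (hp : p ∈ Ξ) :
    pd1 (fun q => (q.2)⁻¹ * pd2 A q) p - pd2 (pd2 fun q => B q / q.2) p =
        (c + 2) / p.2 * pd2 (fun q => B q / q.2) p ∧
      pd1 (pd2 fun q => B q / q.2) p + pd2 (fun q => (q.2)⁻¹ * pd2 A q) p = 0 := by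
  set A' : ℝ × ℝ → ℝ := fun q => (q.2)⁻¹ * pd2 A q with hA'
  set C : ℝ × ℝ → ℝ := fun q => B q / q.2 with hC
  have sA' : ContDiffOn ℝ (⊤ : ℕ∞) A' Ξ :=
    (contDiffOn_snd.inv hsnd).mul (contDiffOn_pd2 hΞ hA)
  have sC : ContDiffOn ℝ (⊤ : ℕ∞) C Ξ := hB.div contDiffOn_snd hsnd
  have dC {q} (hq : q ∈ Ξ) := differentiableAt_of_contDiffOn_top hΞ sC hq
  have dC2 := differentiableAt_of_contDiffOn_top hΞ (contDiffOn_pd2 hΞ sC) hp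
  have eB : EqOn B (fun q => q.2 * C q) Ξ := fun q hq => by
    have := hsnd q hq
    simp only [hC]; field_simp
  have eA : EqOn (pd2 A) (fun q => q.2 * A' q) Ξ := fun q hq => by
    have := hsnd q hq
    simp only [hA']; field_simp
  have e1 : EqOn (pd1 A) (fun q => (c + 1) * C q + q.2 * pd2 C q) Ξ := fun q hq => by
    have h := h1 q hq
    rw [pd2_congr_of_eqOn hΞ eB hq, pd2_snd_mul (dC hq), eB hq] at h
    have := hsnd q hq
    field_simp at h
    linear_combination h
  have e2 : EqOn (pd1 C) (fun q => -A' q) Ξ := fun q hq => by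
    have h := h2 q hq
    rw [pd1_congr_of_eqOn hΞ eB hq, pd1_snd_mul (dC hq), eA hq] at h
    exact mul_left_cancel₀ (hsnd q hq) (by linear_combination h)
  have e3 : p.2 * pd1 A' p = (c + 2) * pd2 C p + p.2 * pd2 (pd2 C) p := by
    rw [← pd1_snd_mul (differentiableAt_of_contDiffOn_top hΞ sA' hp),
      ← pd1_congr_of_eqOn hΞ eA hp, pd1_pd2_comm hΞ hA hp, pd2_congr_of_eqOn hΞ e1 hp]
    have hadd : pd2 (fun q => (c + 1) * C q + q.2 * pd2 C q) p =
        (c + 1) * pd2 C p + pd2 (fun q => q.2 * pd2 C q) p := by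
      have hm : DifferentiableAt ℝ (fun q => q.2 * pd2 C q) p := differentiableAt_snd.mul dC2
      change fderiv ℝ _ p _ = (c + 1) * fderiv ℝ C p _ + fderiv ℝ _ p _
      rw [fderiv_fun_add ((dC hp).const_mul _) hm, fderiv_const_mul (dC hp)]
      simp
    rw [hadd, pd2_snd_mul dC2]
    ring
  constructor
  · have := hsnd p hp
    field_simp
    linear_combination e3
  · rw [pd1_pd2_comm hΞ sC hp, pd2_congr_of_eqOn hΞ e2 hp]
    simp [pd2, fderiv_fun_neg]

end

/-- **Vekua-type system:** if `U, V` are smooth on an open `Ξ ⊆ ℝ²₊` and satisfy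
`∂_{t₁}U − ∂_{t₂}V = 0`, `∂_{t₁}V + ∂_{t₂}U = 0`, then `A = D_{t₂}(n){U}` and
`B = D^{t₂}(n){V}` satisfy `∂_{t₁}A − ∂_{t₂}B = (2n/t₂) B` and `∂_{t₁}B + ∂_{t₂}A = 0`. -/
theorem vekua_system (n : ℕ) (Ξ : Set (ℝ × ℝ)) (hΞopen : IsOpen Ξ)
    (hΞup : Ξ ⊆ {p : ℝ × ℝ | 0 < p.2}) (U V : ℝ × ℝ → ℝ)
    (hU : ContDiffOn ℝ (⊤ : ℕ∞) U Ξ) (hV : ContDiffOn ℝ (⊤ : ℕ∞) V Ξ)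
    (hCR1 : ∀ p ∈ Ξ, pd1 U p - pd2 V p = 0)
    (hCR2 : ∀ p ∈ Ξ, pd1 V p + pd2 U p = 0) :
    ∀ p ∈ Ξ, pd1 (Dlow n U) p - pd2 (Dup n V) p = (2 * n : ℝ) / p.2 * Dup n V p ∧
      pd1 (Dup n V) p + pd2 (Dlow n U) p = 0 := by
  have hsnd : ∀ q ∈ Ξ, q.2 ≠ 0 := fun q hq => (hΞup hq).ne'
  induction n with
  | zero => exact fun p hp => ⟨by simpa [Dlow, Dup] using hCR1 p hp, hCR2 p hp⟩
  | succ n ih =>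
    intro p hp
    have h := vekua_step hΞopen hsnd (contDiffOn_Dlow hΞopen hsnd hU n)
      (contDiffOn_Dup hΞopen hsnd hV n) (fun q hq => (ih q hq).1) (fun q hq => (ih q hq).2) hp
    have hc : (2 * (n + 1 : ℕ) : ℝ) = 2 * n + 2 := by push_cast; ring
    rw [hc]
    exact h
end
end
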